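/- Let X be a nonzero real n×p matrix and let R be a real n×m matrix each of whose rows has unit Euclidean norm, such that Z⋆ = R Rᵀ maximizes trace(X Xᵀ Z) over all real symmetric positive-semidefinite n×n matrices Z with unit diagonal; set α⋆² = trace(R Rᵀ X Xᵀ). Let g be a standard Gaussian random vector in ℝ^m, y = sign(R g), and v = Xᵀ y / ‖Xᵀ y‖₂ (with v = 0 if Xᵀ y = 0). Then for every θ ∈ [0,1], P( ‖X v‖₁² > θ² · (2/π) α⋆² ) ≥ (2/π)(1 − θ²). -/

import Mathlib

open Matrix MeasureTheory
open scoped BigOperators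

/-- The ℓ1 norm of a vector: sum of absolute values of the entries. -/
def l1norm {n : ℕ} (v : Fin n → ℝ) : ℝ := ∑ i, |v i|

/-- The Euclidean (ℓ2) norm of a vector. -/
noncomputable def l2norm {p : ℕ} (u : Fin p → ℝ) : ℝ := Real.sqrt (∑ j, u j ^ 2)

/-- The sign of a real number: `1` if `0 ≤ t` and `-1` otherwise. -/
noncomputable def sgn (t : ℝ) : ℝ := if 0 ≤ t then 1 else -1

/-- The law of a standard Gaussian random vector in ℝ^m: independent standard
normal coordinates. -/
noncomputable def stdGaussian (m : ℕ) : Measure (Fin m → ℝ) :=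
  Measure.pi fun _ : Fin m => ProbabilityTheory.gaussianReal 0 1

open ProbabilityTheory in
instance isProbabilityMeasure_stdGaussian (m : ℕ) : IsProbabilityMeasure (stdGaussian m) := by
  unfold _root_.stdGaussian
  infer_instance

open ProbabilityTheory in
lemma hasGaussianLaw_eval_stdGaussian {m : ℕ} (i : Fin m) :
    HasGaussianLaw (fun g : Fin m → ℝ => g i) (_root_.stdGaussian m) where
  isGaussian_map := by
    have h : Measure.map (fun g : Fin m → ℝ => g i) (_root_.stdGaussian m) = gaussianReal 0 1 :=
      (measurePreserving_eval (fun _ : Fin m => gaussianReal 0 1) i).map_eq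
    rw [h]
    infer_instance

open ProbabilityTheory in
lemma iIndepFun_eval_stdGaussian (m : ℕ) :
    iIndepFun (fun (i : Fin m) (g : Fin m → ℝ) => g i) (_root_.stdGaussian m) :=
  iIndepFun_pi (X := fun _ x => x) (fun _ => aemeasurable_id)

open ProbabilityTheory in
lemma hasGaussianLaw_id_stdGaussian (m : ℕ) :
    HasGaussianLaw (fun g : Fin m → ℝ => g) (_root_.stdGaussian m) :=
  iIndepFun.hasGaussianLaw hasGaussianLaw_eval_stdGaussian (iIndepFun_eval_stdGaussian m)

/-- The linear functional `g ↦ r ⬝ᵥ g` as a continuous linear map. -/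
noncomputable def dotCLM {m : ℕ} (r : Fin m → ℝ) : (Fin m → ℝ) →L[ℝ] ℝ :=
  ∑ i, r i • ContinuousLinearMap.proj (R := ℝ) (φ := fun _ : Fin m => ℝ) i

lemma dotCLM_apply {m : ℕ} (r g : Fin m → ℝ) : dotCLM r g = r ⬝ᵥ g := by
  simp [dotCLM, dotProduct]

open ProbabilityTheory in
lemma memLp_dotProduct_stdGaussian {m : ℕ} (r : Fin m → ℝ) :
    MemLp (fun g => r ⬝ᵥ g) 2 (_root_.stdGaussian m) := by
  simpa only [dotCLM_apply] using
    ((hasGaussianLaw_id_stdGaussian m).map_fun (dotCLM r)).memLp_two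

open ProbabilityTheory in
lemma integral_comp_eval_stdGaussian {m : ℕ} (i : Fin m) {f : ℝ → ℝ} (hf : Continuous f) :
    ∫ g, f (g i) ∂(_root_.stdGaussian m) = ∫ x, f x ∂(gaussianReal 0 1) := by
  have h := measurePreserving_eval (fun _ : Fin m => gaussianReal 0 1) i
  rw [← h.map_eq, integral_map h.measurable.aemeasurable hf.aestronglyMeasurable]
  rfl

open ProbabilityTheory in
lemma integral_eval_stdGaussian {m : ℕ} (i : Fin m) :
    ∫ g, g i ∂(_root_.stdGaussian m) = 0 := by
  rw [integral_comp_eval_stdGaussian i continuous_id']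
  exact integral_id_gaussianReal

open ProbabilityTheory in
lemma integral_eval_mul_eval_stdGaussian {m : ℕ} (i j : Fin m) :
    ∫ g, g i * g j ∂(_root_.stdGaussian m) = if i = j then 1 else 0 := by
  split_ifs with hij
  · subst hij
    rw [integral_comp_eval_stdGaussian i (f := fun x => x * x) (by fun_prop)]
    have h := variance_fun_id_gaussianReal (μ := 0) (v := 1)
    rw [variance_of_integral_eq_zero aemeasurable_id' integral_id_gaussianReal] at h
    simpa [pow_two] using h
  · have h := ((iIndepFun_eval_stdGaussian m).indepFun hij).integral_fun_mul_eq_mul_integral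
      (measurable_pi_apply i).aestronglyMeasurable (measurable_pi_apply j).aestronglyMeasurable
    rw [h, integral_eval_stdGaussian, zero_mul]

lemma integral_dotProduct_stdGaussian {m : ℕ} (r : Fin m → ℝ) :
    ∫ g, r ⬝ᵥ g ∂(stdGaussian m) = 0 := by
  have h (i : Fin m) : Integrable (fun g : Fin m → ℝ => g i) (stdGaussian m) :=
    (hasGaussianLaw_eval_stdGaussian i).integrable
  simp only [dotProduct]
  rw [integral_finsetSum _ fun i _ => (h i).const_mul _]
  simp [integral_const_mul, integral_eval_stdGaussian]

lemma integral_dotProduct_mul_dotProduct_stdGaussian {m : ℕ} (r s : Fin m → ℝ) :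
    ∫ g, (r ⬝ᵥ g) * (s ⬝ᵥ g) ∂(stdGaussian m) = r ⬝ᵥ s := by
  have h (i j : Fin m) : Integrable (fun g : Fin m → ℝ => g i * g j) (stdGaussian m) :=
    (hasGaussianLaw_eval_stdGaussian i).memLp_two.integrable_mul
      (hasGaussianLaw_eval_stdGaussian j).memLp_two
  have h2 (g : Fin m → ℝ) : (r ⬝ᵥ g) * (s ⬝ᵥ g) = ∑ i, ∑ j, (r i * s j) * (g i * g j) := by
    simp only [dotProduct, Finset.sum_mul_sum]
    exact Finset.sum_congr rfl fun i _ => Finset.sum_congr rfl fun j _ => by ring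
  simp only [h2]
  rw [integral_finsetSum _ fun i _ => integrable_finsetSum _ fun j _ => (h i j).const_mul _]
  simp_rw [integral_finsetSum _ fun j _ => (h _ j).const_mul _, integral_const_mul,
    integral_eval_mul_eval_stdGaussian]
  simp [dotProduct]

open ProbabilityTheory in
lemma map_dotProduct_stdGaussian {m : ℕ} {r : Fin m → ℝ} (hr : r ⬝ᵥ r = 1) :
    (_root_.stdGaussian m).map (fun g => r ⬝ᵥ g) = gaussianReal 0 1 := by
  have h := (hasGaussianLaw_id_stdGaussian m).map_fun (dotCLM r)
  simp only [dotCLM_apply] at h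
  have h2 := h.map_eq_gaussianReal
  rw [variance_of_integral_eq_zero h.aemeasurable (integral_dotProduct_stdGaussian r)] at h2
  simp only [integral_dotProduct_stdGaussian, pow_two,
    integral_dotProduct_mul_dotProduct_stdGaussian, hr] at h2
  simpa using h2

lemma measurable_sgn : Measurable sgn :=
  Measurable.ite measurableSet_Ici measurable_const measurable_const

lemma sgn_mul_self (t : ℝ) : sgn t * t = |t| := by
  unfold sgn
  split_ifs with h
  · simp [abs_of_nonneg h]
  · simp [abs_of_neg (not_le.mp h)]

lemma abs_sgn (t : ℝ) : |sgn t| = 1 := by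
  unfold sgn
  split_ifs <;> simp

open ProbabilityTheory in
lemma integral_abs_gaussianReal_zero_one :
    ∫ x, |x| ∂(gaussianReal 0 1) = √(2 / Real.pi) := by
  rw [integral_gaussianReal_eq_integral_smul one_ne_zero]
  have h1 : (fun x : ℝ => gaussianPDFReal 0 1 x • |x|) =
      fun x => (fun y : ℝ => (√(2 * Real.pi))⁻¹ * (y * Real.exp (-(1 / 2) * y ^ 2))) |x| := by
    ext x
    simp [gaussianPDFReal]
    ring_nf
  rw [h1, integral_comp_abs (f := fun y : ℝ =>
    (√(2 * Real.pi))⁻¹ * (y * Real.exp (-(1 / 2) * y ^ 2))), integral_const_mul]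
  have h2 : ∫ x in Set.Ioi (0 : ℝ), x * Real.exp (-(1 / 2) * x ^ 2) = 1 := by
    have := integral_rpow_mul_exp_neg_mul_rpow (p := 2) (q := 1) (b := 1 / 2) (by norm_num)
      (by norm_num) (by norm_num)
    norm_num at this ⊢
    exact this
  rw [h2]
  have h3 : √(2 * Real.pi) ≠ 0 := by positivity
  rw [eq_comm, Real.sqrt_eq_iff_mul_self_eq (by positivity) (by positivity)]
  have := Real.sq_sqrt (show 0 ≤ 2 * Real.pi by positivity)
  field_simp
  nlinarith

open ProbabilityTheory in
lemma integral_sgn_dotProduct_mul_of_orthogonal {m : ℕ} {r t : Fin m → ℝ} (h : r ⬝ᵥ t = 0) :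
    ∫ g, sgn (r ⬝ᵥ g) * (t ⬝ᵥ g) ∂(_root_.stdGaussian m) = 0 := by
  have hg := (hasGaussianLaw_id_stdGaussian m).map_fun ((dotCLM r).prod (dotCLM t))
  simp only [ContinuousLinearMap.prod_apply, dotCLM_apply] at hg
  have hind : IndepFun (fun g => r ⬝ᵥ g) (fun g => t ⬝ᵥ g) (_root_.stdGaussian m) := by
    refine hg.indepFun_of_covariance_eq_zero ?_
    simp [covariance, integral_dotProduct_stdGaussian,
      integral_dotProduct_mul_dotProduct_stdGaussian, h]
  have hind' := hind.comp measurable_sgn measurable_id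
  have := hind'.integral_fun_mul_eq_mul_integral
    (measurable_sgn.comp_aemeasurable (hg.fst.aemeasurable)).aestronglyMeasurable
    (hg.snd.aemeasurable).aestronglyMeasurable
  simpa [integral_dotProduct_stdGaussian] using this

lemma integrable_sgn_dotProduct_mul {m : ℕ} (r : Fin m → ℝ) {f : (Fin m → ℝ) → ℝ}
    (hf : Integrable f (stdGaussian m)) :
    Integrable (fun g => sgn (r ⬝ᵥ g) * f g) (stdGaussian m) := by
  refine hf.bdd_mul (c := 1) ?_ ?_
  · exact (measurable_sgn.comp_aemeasurable
      (memLp_dotProduct_stdGaussian r).aestronglyMeasurable.aemeasurable).aestronglyMeasurable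
  · exact Filter.Eventually.of_forall fun g => by simp [abs_sgn]

lemma integral_sgn_dotProduct_mul_dotProduct {m : ℕ} {r : Fin m → ℝ} (hr : r ⬝ᵥ r = 1)
    (s : Fin m → ℝ) :
    ∫ g, sgn (r ⬝ᵥ g) * (s ⬝ᵥ g) ∂(stdGaussian m) = √(2 / Real.pi) * (r ⬝ᵥ s) := by
  set t : Fin m → ℝ := s - (r ⬝ᵥ s) • r with ht
  have hrt : r ⬝ᵥ t = 0 := by simp [ht, dotProduct_sub, hr]
  have hs (g : Fin m → ℝ) : sgn (r ⬝ᵥ g) * (s ⬝ᵥ g) =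
      (r ⬝ᵥ s) * (sgn (r ⬝ᵥ g) * (r ⬝ᵥ g)) + sgn (r ⬝ᵥ g) * (t ⬝ᵥ g) := by
    simp only [ht, sub_dotProduct, smul_dotProduct, smul_eq_mul]
    ring
  have hint (a : Fin m → ℝ) := integrable_sgn_dotProduct_mul r
    ((memLp_dotProduct_stdGaussian a).integrable one_le_two)
  simp only [hs]
  rw [integral_add ((hint r).const_mul _) (hint t), integral_const_mul,
    integral_sgn_dotProduct_mul_of_orthogonal hrt]
  simp only [sgn_mul_self]
  rw [← integral_map (φ := fun g => r ⬝ᵥ g) (f := fun x => |x|)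
    (memLp_dotProduct_stdGaussian r).aestronglyMeasurable.aemeasurable (by fun_prop),
    map_dotProduct_stdGaussian hr, integral_abs_gaussianReal_zero_one]
  ring

lemma two_div_pi_mul_le_integral_sq_dotProduct_sgn {n m : ℕ} {R : Matrix (Fin n) (Fin m) ℝ}
    (hR : ∀ i, R i ⬝ᵥ R i = 1) (x : Fin n → ℝ) :
    2 / Real.pi * ((x ᵥ* R) ⬝ᵥ (x ᵥ* R)) ≤
      ∫ g, (x ⬝ᵥ fun i => sgn (R i ⬝ᵥ g)) ^ 2 ∂(stdGaussian m) := by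
  set c : ℝ := √(2 / Real.pi)
  have hc : c ^ 2 = 2 / Real.pi := Real.sq_sqrt (by positivity)
  set W : (Fin m → ℝ) → ℝ := fun g => x ⬝ᵥ fun i => sgn (R i ⬝ᵥ g) with hW
  set s : Fin m → ℝ := x ᵥ* R with hs
  have hU := memLp_dotProduct_stdGaussian s
  have hUi := hU.integrable one_le_two
  have hWm : MemLp W 2 (stdGaussian m) := by
    refine memLp_finsetSum _ fun i _ => MemLp.const_mul ?_ _
    refine MemLp.of_bound ?_ 1 (Filter.Eventually.of_forall fun g => by simp [abs_sgn])
    exact (measurable_sgn.comp_aemeasurable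
      (memLp_dotProduct_stdGaussian (R i)).aestronglyMeasurable.aemeasurable).aestronglyMeasurable
  have hWU : ∫ g, W g * (s ⬝ᵥ g) ∂(stdGaussian m) = c * (s ⬝ᵥ s) := by
    have h (g : Fin m → ℝ) : W g * (s ⬝ᵥ g) = ∑ i, x i * (sgn (R i ⬝ᵥ g) * (s ⬝ᵥ g)) := by
      simp only [hW, dotProduct, Finset.sum_mul, mul_assoc]
    simp only [h]
    rw [integral_finsetSum _ fun i _ => (integrable_sgn_dotProduct_mul (R i) hUi).const_mul _]
    simp only [integral_const_mul, integral_sgn_dotProduct_mul_dotProduct (hR _)]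
    have h2 : s ⬝ᵥ s = ∑ i, x i * (R i ⬝ᵥ s) := by
      conv_lhs => rw [hs, ← dotProduct_mulVec]
      rfl
    rw [h2, Finset.mul_sum]
    exact Finset.sum_congr rfl fun i _ => by ring
  have hUU := integral_dotProduct_mul_dotProduct_stdGaussian s s
  have hexp : ∫ g, (W g - c * (s ⬝ᵥ g)) ^ 2 ∂(stdGaussian m) =
      ∫ g, W g ^ 2 ∂(stdGaussian m) - 2 / Real.pi * (s ⬝ᵥ s) := by
    have h (g : Fin m → ℝ) : (W g - c * (s ⬝ᵥ g)) ^ 2 =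
        W g ^ 2 - 2 * c * (W g * (s ⬝ᵥ g)) + c ^ 2 * ((s ⬝ᵥ g) * (s ⬝ᵥ g)) := by ring
    simp only [h]
    have i1 : Integrable (fun g => W g ^ 2) (stdGaussian m) := hWm.integrable_sq
    have i2 : Integrable (fun g => W g * (s ⬝ᵥ g)) (stdGaussian m) := hWm.integrable_mul hU
    have i3 : Integrable (fun g => (s ⬝ᵥ g) * (s ⬝ᵥ g)) (stdGaussian m) := hU.integrable_mul hU
    have i12 : Integrable (fun g => W g ^ 2 - 2 * c * (W g * (s ⬝ᵥ g))) (stdGaussian m) :=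
      i1.sub (i2.const_mul _)
    rw [integral_add i12 (i3.const_mul _), integral_sub i1 (i2.const_mul _), integral_const_mul, integral_const_mul, hWU, hUU, ← hc]
    ring
  have hnn : 0 ≤ ∫ g, (W g - c * (s ⬝ᵥ g)) ^ 2 ∂(stdGaussian m) :=
    integral_nonneg fun g => sq_nonneg _
  linarith

/-- Lower tail bound for a random variable bounded above by `B`. -/
lemma integral_le_add_mul_measureReal_lt {Ω : Type*} [MeasurableSpace Ω] {μ : Measure Ω}
    [IsProbabilityMeasure μ] {f : Ω → ℝ} (hf : Integrable f μ) (hfm : Measurable f) {a B : ℝ}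
    (ha : 0 ≤ a) (hB : ∀ ω, f ω ≤ B) :
    ∫ ω, f ω ∂μ ≤ a + B * μ.real {ω | a < f ω} := by
  have hS : MeasurableSet {ω | a < f ω} := measurableSet_lt measurable_const hfm
  have hi : Integrable ({ω | a < f ω}.indicator fun _ => B) μ :=
    (integrable_const B).indicator hS
  calc ∫ ω, f ω ∂μ ≤ ∫ ω, (a + {ω | a < f ω}.indicator (fun _ => B) ω) ∂μ := by
        refine integral_mono hf ((integrable_const a).add hi) fun ω => ?_
        by_cases h : a < f ω
        · simp only [Set.indicator, Set.mem_ofPred_eq, h, if_true]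
          linarith [hB ω]
        · simp only [Set.indicator, Set.mem_ofPred_eq, h, if_false]
          linarith
    _ = a + B * μ.real {ω | a < f ω} := by
        rw [integral_add (integrable_const a) hi, integral_indicator hS]
        simp [mul_comm]

lemma l2norm_sq {p : ℕ} (u : Fin p → ℝ) : l2norm u ^ 2 = u ⬝ᵥ u := by
  rw [l2norm, Real.sq_sqrt (Finset.sum_nonneg fun i _ => sq_nonneg _)]
  simp [dotProduct, pow_two]

lemma dotProduct_le_l1norm {n : ℕ} {y : Fin n → ℝ} (hy : ∀ i, |y i| = 1) (w : Fin n → ℝ) :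
    y ⬝ᵥ w ≤ l1norm w := by
  refine Finset.sum_le_sum fun i _ => (le_abs_self _).trans ?_
  rw [abs_mul, hy, one_mul]

lemma l2norm_sq_le_l1norm_sq {n p : ℕ} (X : Matrix (Fin n) (Fin p) ℝ) {y : Fin n → ℝ}
    (hy : ∀ i, |y i| = 1) :
    l2norm (Xᵀ *ᵥ y) ^ 2 ≤ l1norm (X *ᵥ ((l2norm (Xᵀ *ᵥ y))⁻¹ • Xᵀ *ᵥ y)) ^ 2 := by
  have hN : 0 ≤ l2norm (Xᵀ *ᵥ y) := Real.sqrt_nonneg _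
  refine pow_le_pow_left₀ hN ?_ 2
  refine le_trans (le_of_eq ?_) (dotProduct_le_l1norm hy _)
  rw [mulVec_smul, dotProduct_smul, dotProduct_mulVec, ← mulVec_transpose, ← l2norm_sq,
    smul_eq_mul]
  rcases eq_or_ne (l2norm (Xᵀ *ᵥ y)) 0 with h | h
  · simp [h]
  · field_simp

lemma l2norm_sq_le_of_trace_le {n p : ℕ} {X : Matrix (Fin n) (Fin p) ℝ} {a : ℝ}
    (hmax : ∀ Z : Matrix (Fin n) (Fin n) ℝ, Z.PosSemidef → (∀ i, Z i i = 1) →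
      (X * Xᵀ * Z).trace ≤ a) {y : Fin n → ℝ} (hy : ∀ i, |y i| = 1) :
    l2norm (Xᵀ *ᵥ y) ^ 2 ≤ a := by
  have h := hmax (vecMulVec y y) (by simpa using posSemidef_vecMulVec_self_star y) fun i => by
    rw [vecMulVec_apply, ← abs_mul_abs_self, hy, one_mul]
  rwa [mul_vecMulVec, trace_vecMulVec, ← mulVec_mulVec, dotProduct_comm, dotProduct_mulVec,
    ← mulVec_transpose, ← l2norm_sq] at h

lemma trace_gram_mul_gram {n p m : ℕ} (X : Matrix (Fin n) (Fin p) ℝ)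
    (R : Matrix (Fin n) (Fin m) ℝ) :
    (R * Rᵀ * (X * Xᵀ)).trace = ∑ k, (Xᵀ k ᵥ* R) ⬝ᵥ (Xᵀ k ᵥ* R) := by
  have h : R * Rᵀ * (X * Xᵀ) = (R * (Xᵀ * R)ᵀ) * Xᵀ := by
    simp [Matrix.mul_assoc, transpose_mul]
  rw [h, Matrix.trace_mul_comm, ← Matrix.mul_assoc]
  rfl

lemma trace_self_mul_transpose_pos {n p : ℕ} {X : Matrix (Fin n) (Fin p) ℝ} (hX : X ≠ 0) :
    0 < (X * Xᵀ).trace := by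
  have h := (posSemidef_self_mul_conjTranspose X).trace_nonneg
  have h2 := mt trace_mul_conjTranspose_self_eq_zero_iff.mp hX
  rw [conjTranspose_eq_transpose_of_trivial] at h h2
  exact lt_of_le_of_ne h (Ne.symm h2)

theorem rounding_success_probability {n p m : ℕ} (X : Matrix (Fin n) (Fin p) ℝ)
    (hX : X ≠ 0)
    (R : Matrix (Fin n) (Fin m) ℝ)
    (hrows : ∀ i, ∑ j, R i j ^ 2 = 1)
    (hmax : ∀ Z : Matrix (Fin n) (Fin n) ℝ, Z.PosSemidef → (∀ i, Z i i = 1) →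
      (X * Xᵀ * Z).trace ≤ (X * Xᵀ * (R * Rᵀ)).trace)
    (αsq : ℝ) (hα : αsq = (R * Rᵀ * (X * Xᵀ)).trace)
    (y : (Fin m → ℝ) → Fin n → ℝ)
    (hy : ∀ g, y g = fun i => sgn (R.mulVec g i))
    (v : (Fin m → ℝ) → Fin p → ℝ)
    (hv : ∀ g, v g = (l2norm (Xᵀ.mulVec (y g)))⁻¹ • Xᵀ.mulVec (y g))
    (θ : ℝ) (hθ : θ ∈ Set.Icc (0 : ℝ) 1) :
    2 / Real.pi * (1 - θ ^ 2) ≤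
      ((stdGaussian m) {g | θ ^ 2 * (2 / Real.pi * αsq) < l1norm (X.mulVec (v g)) ^ 2}).toReal := by
  have hR (i : Fin n) : R i ⬝ᵥ R i = 1 := by
    simpa [dotProduct, pow_two] using hrows i
  have hα' : (X * Xᵀ * (R * Rᵀ)).trace = αsq := by rw [hα, Matrix.trace_mul_comm]
  rw [hα'] at hmax
  have hyabs (g : Fin m → ℝ) (i : Fin n) : |y g i| = 1 := by rw [hy, abs_sgn]
  have hpos : 0 < αsq := (trace_self_mul_transpose_pos hX).trans_le <| by
    simpa using hmax 1 PosSemidef.one (by simp)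
  set f : (Fin m → ℝ) → ℝ := fun g => l2norm (Xᵀ *ᵥ y g) ^ 2 with hf
  have hfB (g : Fin m → ℝ) : f g ≤ αsq := l2norm_sq_le_of_trace_le hmax (hyabs g)
  have hfsum (g : Fin m → ℝ) : f g = ∑ k, (Xᵀ k ⬝ᵥ fun i => sgn (R i ⬝ᵥ g)) ^ 2 := by
    simp only [hf, l2norm_sq, hy]
    simp only [pow_two]
    rfl
  have hterm (k : Fin p) :
      Measurable fun g : Fin m → ℝ => (Xᵀ k ⬝ᵥ fun i => sgn (R i ⬝ᵥ g)) ^ 2 := by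
    refine Measurable.pow_const (Finset.measurable_fun_sum _ fun i _ => ?_) 2
    refine (measurable_sgn.comp ?_).const_mul _
    exact Finset.measurable_fun_sum _ fun j _ => (measurable_pi_apply j).const_mul _
  have hfm : Measurable f := by
    simp only [funext hfsum]
    exact Finset.measurable_fun_sum _ fun k _ => hterm k
  have hfi : Integrable f (stdGaussian m) :=
    Integrable.of_bound hfm.aestronglyMeasurable αsq (Filter.Eventually.of_forall fun g => by
      rw [Real.norm_of_nonneg (sq_nonneg _)]
      exact hfB g)
  have hmean : 2 / Real.pi * αsq ≤ ∫ g, f g ∂(stdGaussian m) := by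
    simp only [hfsum]
    rw [integral_finsetSum _ fun k _ => ?_, hα, trace_gram_mul_gram, Finset.mul_sum]
    · exact Finset.sum_le_sum fun k _ => two_div_pi_mul_le_integral_sq_dotProduct_sgn hR _
    · refine Integrable.of_bound (hterm k).aestronglyMeasurable αsq
        (Filter.Eventually.of_forall fun g => ?_)
      rw [Real.norm_of_nonneg (sq_nonneg _)]
      refine le_trans ?_ ((hfsum g).symm.trans_le (hfB g))
      exact Finset.single_le_sum
        (f := fun k => (Xᵀ k ⬝ᵥ fun i => sgn (R i ⬝ᵥ g)) ^ 2)
        (fun k _ => sq_nonneg _) (Finset.mem_univ k)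
  have htail := integral_le_add_mul_measureReal_lt hfi hfm
    (a := θ ^ 2 * (2 / Real.pi * αsq)) (by positivity) hfB
  have hsub : (stdGaussian m).real {g | θ ^ 2 * (2 / Real.pi * αsq) < f g} ≤
      (stdGaussian m).real {g | θ ^ 2 * (2 / Real.pi * αsq) < l1norm (X.mulVec (v g)) ^ 2} := by
    refine measureReal_mono fun g hg => ?_
    simp only [Set.mem_ofPred_eq, hv] at hg ⊢
    exact hg.trans_le (l2norm_sq_le_l1norm_sq X (hyabs g))
  refine le_trans ?_ hsub
  refine le_of_mul_le_mul_left ?_ hpos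
  linarith
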